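/- arXiv:0901.4665 — 2 statements merged into one kernel-verified Lean document; each statement's English description precedes it below -/
import Mathlib

section
/- Let f be (N−1) times continuously differentiable on [a,b]. Then the difference operator (E − aI)^N (E − bI)^N annihilates the boundary sequence: for every k ∈ ℕ, Σ_{r=0}^N Σ_{s=0}^N binom(N,r) binom(N,s) (−a)^{N−r} (−b)^{N−s} ε_{k+r+s} = 0. -/
open Finset Polynomial

/-- The boundary ("bilinear concomitant") sequence
`ε_k = [ Σ_{j=1}^N Σ_{i=0}^{j−1} (−1)^i f^{(j−1−i)}(x) (d/dx)^i ( x^k p_j(x) ) ]_{x=a}^{x=b}`. -/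
noncomputable def concomitantSeq (N : ℕ) (p : ℕ → Polynomial ℝ) (f : ℝ → ℝ)
    (a b : ℝ) (k : ℕ) : ℝ :=
  (∑ j ∈ Finset.Icc 1 N, ∑ i ∈ Finset.range j,
      (-1 : ℝ) ^ i * iteratedDerivWithin (j - 1 - i) f (Set.Icc a b) b *
        ((fun q => Polynomial.derivative q)^[i] (Polynomial.X ^ k * p j)).eval b)
  - (∑ j ∈ Finset.Icc 1 N, ∑ i ∈ Finset.range j,
      (-1 : ℝ) ^ i * iteratedDerivWithin (j - 1 - i) f (Set.Icc a b) a *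
        ((fun q => Polynomial.derivative q)^[i] (Polynomial.X ^ k * p j)).eval a)

/-- The part of the bilinear concomitant attached to the endpoint `c`, as a linear functional of the
test polynomial; `w n` plays the role of the `n`-th derivative of `f` at `c`. -/
noncomputable def concomitantAt (N : ℕ) (p : ℕ → Polynomial ℝ) (w : ℕ → ℝ) (c : ℝ) :
    Polynomial ℝ →ₗ[ℝ] ℝ :=
  ∑ j ∈ Finset.Icc 1 N, ∑ i ∈ Finset.range j,
    ((-1 : ℝ) ^ i * w (j - 1 - i)) •
      (Polynomial.leval c ∘ₗ (Polynomial.derivative ^ i) ∘ₗ LinearMap.mulRight ℝ (p j))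

lemma concomitantAt_apply (N : ℕ) (p : ℕ → Polynomial ℝ) (w : ℕ → ℝ) (c : ℝ)
    (q : Polynomial ℝ) :
    concomitantAt N p w c q = ∑ j ∈ Finset.Icc 1 N, ∑ i ∈ Finset.range j,
      (-1 : ℝ) ^ i * w (j - 1 - i) *
        ((fun q => Polynomial.derivative q)^[i] (q * p j)).eval c := by
  simp [concomitantAt, LinearMap.sum_apply, Module.End.pow_apply]

lemma concomitantSeq_eq_sub (N : ℕ) (p : ℕ → Polynomial ℝ) (f : ℝ → ℝ) (a b : ℝ) (k : ℕ) :
    concomitantSeq N p f a b k =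
      concomitantAt N p (fun n => iteratedDerivWithin n f (Set.Icc a b) b) b (X ^ k) -
      concomitantAt N p (fun n => iteratedDerivWithin n f (Set.Icc a b) a) a (X ^ k) := by
  simp only [concomitantAt_apply, concomitantSeq]

lemma concomitantAt_eq_zero_of_dvd (N : ℕ) (p : ℕ → Polynomial ℝ) (w : ℕ → ℝ) (c : ℝ)
    {q : Polynomial ℝ} (hq : (X - C c) ^ N ∣ q) : concomitantAt N p w c q = 0 := by
  rw [concomitantAt_apply]
  refine Finset.sum_eq_zero fun j hj => Finset.sum_eq_zero fun i hi => ?_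
  have hiN : N - i ≠ 0 := by
    have := (Finset.mem_Icc.mp hj).2
    have := Finset.mem_range.mp hi
    omega
  have hdvd : X - C c ∣ derivative^[i] (q * p j) :=
    (dvd_pow_self _ hiN).trans
      (pow_sub_dvd_iterate_derivative_of_pow_dvd i (hq.mul_right (p j)))
  exact mul_eq_zero_of_right _ (dvd_iff_isRoot.mp hdvd)

lemma sum_choose_smul_X_pow (a b : ℝ) (N k : ℕ) :
    ∑ r ∈ Finset.range (N + 1), ∑ s ∈ Finset.range (N + 1),
      ((N.choose r : ℝ) * (N.choose s : ℝ) * (-a) ^ (N - r) * (-b) ^ (N - s)) •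
        (X : Polynomial ℝ) ^ (k + r + s) =
      X ^ k * ((X - C a) ^ N * (X - C b) ^ N) := by
  rw [sub_eq_add_neg, sub_eq_add_neg, add_pow, add_pow, Finset.sum_mul_sum]
  simp only [Finset.mul_sum, smul_eq_C_mul]
  refine Finset.sum_congr rfl fun r _ => Finset.sum_congr rfl fun s _ => ?_
  simp only [C_mul, C_pow, C_neg, map_natCast]
  ring

theorem difference_operator_annihilates_concomitant (a b : ℝ) (hab : a < b)
    (N : ℕ) (hN : 1 ≤ N) (p : ℕ → Polynomial ℝ) (f : ℝ → ℝ)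
    (hf : ContDiffOn ℝ (N - 1 : ℕ) f (Set.Icc a b)) :
    ∀ k : ℕ, ∑ r ∈ Finset.range (N + 1), ∑ s ∈ Finset.range (N + 1),
      (N.choose r : ℝ) * (N.choose s : ℝ) * (-a) ^ (N - r) * (-b) ^ (N - s) *
        concomitantSeq N p f a b (k + r + s) = 0 := by
  intro k
  simp only [concomitantSeq_eq_sub, mul_sub, Finset.sum_sub_distrib, ← smul_eq_mul (_ * _ : ℝ)
    (concomitantAt _ _ _ _ _), ← map_smul, ← map_sum, sum_choose_smul_X_pow]
  rw [concomitantAt_eq_zero_of_dvd _ _ _ b ((dvd_mul_left _ _).mul_left _),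
    concomitantAt_eq_zero_of_dvd _ _ _ a ((dvd_mul_right _ _).mul_left _), sub_zero]
end

section
/- Let a = ξ_0 < ξ_1 < ⋯ < ξ_{p+1} = b be a partition of [a,b], and for each n = 0,…,p let f_n be N times continuously differentiable on [ξ_n, ξ_{n+1}] with Σ_{j=0}^N p_j(x) f_n^{(j)}(x) = 0 for all x ∈ [ξ_n, ξ_{n+1}]. Define m_k = Σ_{n=0}^p ∫_{ξ_n}^{ξ_{n+1}} x^k f_n(x) dx for k ≥ 0 and m_k = 0 for k < 0, and let c_t denote the coefficient of X^t in the polynomial ∏_{n=0}^{p+1} (X − ξ_n)^N. Then for every k ∈ ℕ: Σ_{t=0}^{N(p+2)} c_t Σ_{j=0}^N Σ_{i=0}^{d_j} a_{i,j} (−1)^j (i+k+t)_j · m_{k+t+i−j} = 0. -/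
open Finset intervalIntegral Polynomial

/-- The falling factorial `(x)_j = x(x−1)⋯(x−j+1)`, with `(x)_0 = 1`. -/
noncomputable def fallingFactorial (x : ℝ) (j : ℕ) : ℝ :=
  ∏ l ∈ Finset.range j, (x - l)

theorem integral_eval_mul_iteratedDerivWithin {u v : ℝ} (huv : u < v) {N : ℕ} {f : ℝ → ℝ}
    (hf : ContDiffOn ℝ N f (Set.Icc u v)) {j : ℕ} (hj : j ≤ N) {R : ℝ[X]}
    (hu : (X - C u) ^ j ∣ R) (hv : (X - C v) ^ j ∣ R) :
    ∫ x in u..v, R.eval x * iteratedDerivWithin j f (Set.Icc u v) x =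
      (-1) ^ j * ∫ x in u..v, (derivative^[j] R).eval x * f x := by
  induction j generalizing R with
  | zero => simp
  | succ j ih =>
    have hs : UniqueDiffOn ℝ (Set.Icc u v) := uniqueDiffOn_Icc huv
    have hIcc : Set.uIcc u v = Set.Icc u v := Set.uIcc_of_le huv.le
    have root {w : ℝ} (h : (X - C w) ^ (j + 1) ∣ R) : R.eval w = 0 :=
      dvd_iff_isRoot.1 ((dvd_pow_self _ j.succ_ne_zero).trans h)
    have hjN : j < N := hj
    have hcont : ContinuousOn (iteratedDerivWithin (j + 1) f (Set.Icc u v)) (Set.Icc u v) :=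
      hf.continuousOn_iteratedDerivWithin (Nat.cast_le.2 hj) hs
    have hdiff : DifferentiableOn ℝ (iteratedDerivWithin j f (Set.Icc u v)) (Set.Icc u v) :=
      hf.differentiableOn_iteratedDerivWithin (Nat.cast_lt.2 hjN) hs
    have parts := integral_mul_deriv_eq_deriv_mul_of_hasDerivWithinAt
      (a := u) (b := v) (u := fun x => R.eval x) (u' := fun x => (derivative R).eval x)
      (v := iteratedDerivWithin j f (Set.Icc u v))
      (v' := iteratedDerivWithin (j + 1) f (Set.Icc u v))
      (fun x _ => (R.hasDerivAt x).hasDerivWithinAt)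
      (fun x hx => by
        rw [hIcc] at hx ⊢
        rw [iteratedDerivWithin_succ]
        exact (hdiff x hx).hasDerivWithinAt)
      ((derivative R).continuous.intervalIntegrable u v)
      (ContinuousOn.intervalIntegrable (hIcc ▸ hcont))
    simp only [root hu, root hv, zero_mul, sub_self, zero_sub] at parts
    have dvd' {w : ℝ} (h : (X - C w) ^ (j + 1) ∣ R) : (X - C w) ^ j ∣ derivative R := by
      simpa using pow_sub_one_dvd_derivative_of_pow_dvd h
    rw [parts, ih hjN.le (dvd' hu) (dvd' hv), Function.iterate_succ_apply, pow_succ]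
    ring

theorem exists_linearMap_eq_sum_integral (ξ : ℕ → ℝ) (F : ℕ → ℝ → ℝ) (s : Finset ℕ)
    (hF : ∀ n ∈ s, ContinuousOn (F n) (Set.uIcc (ξ n) (ξ (n + 1)))) :
    ∃ L : ℝ[X] →ₗ[ℝ] ℝ, ∀ R : ℝ[X],
      L R = ∑ n ∈ s, ∫ x in (ξ n)..(ξ (n + 1)), R.eval x * F n x := by
  refine ⟨{
    toFun := fun R => ∑ n ∈ s, ∫ x in (ξ n)..(ξ (n + 1)), R.eval x * F n x
    map_add' := fun P Q => ?_
    map_smul' := fun r P => ?_ }, fun R => rfl⟩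
  · rw [← Finset.sum_add_distrib]
    refine Finset.sum_congr rfl fun n hn => ?_
    have key (R : ℝ[X]) :
        IntervalIntegrable (fun x => R.eval x * F n x) MeasureTheory.volume (ξ n) (ξ (n + 1)) :=
      (R.continuous.continuousOn.mul (hF n hn)).intervalIntegrable
    rw [← intervalIntegral.integral_add (key P) (key Q)]
    simp only [eval_add, add_mul]
  · simp only [eval_smul, smul_eq_mul, mul_assoc, intervalIntegral.integral_const_mul,
      Finset.mul_sum, RingHom.id_apply]

theorem fallingFactorial_natCast (s j : ℕ) :
    fallingFactorial (s : ℝ) j = (s.descFactorial j : ℝ) := by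
  rw [fallingFactorial, ← descPochhammer_eval_eq_descFactorial, descPochhammer_eval_eq_prod_range]

theorem map_iterate_derivative_X_pow {m : ℤ → ℝ} {L : ℝ[X] →ₗ[ℝ] ℝ}
    (hL : ∀ k : ℕ, L (X ^ k) = m k) (s j : ℕ) :
    L (derivative^[j] (X ^ s)) = fallingFactorial (s : ℝ) j * m ((s : ℤ) - j) := by
  rw [iterate_derivative_X_pow_eq_smul, map_smul, hL, smul_eq_mul, fallingFactorial_natCast]
  rcases le_or_gt j s with h | h
  · rw [Nat.cast_sub h]
  · simp [Nat.descFactorial_eq_zero_iff_lt.2 h]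

theorem piecewise_moment_recurrence (a b : ℝ) (hab : a < b) (N : ℕ) (hN : 1 ≤ N)
    (d : ℕ → ℕ) (A : ℕ → ℕ → ℝ) (p : ℕ) (ξ : ℕ → ℝ)
    (hξa : ξ 0 = a) (hξb : ξ (p + 1) = b)
    (hξmono : ∀ n ≤ p, ξ n < ξ (n + 1))
    (F : ℕ → ℝ → ℝ)
    (hF : ∀ n ≤ p, ContDiffOn ℝ (N : ℕ) (F n) (Set.Icc (ξ n) (ξ (n + 1))))
    (hode : ∀ n ≤ p, ∀ x ∈ Set.Icc (ξ n) (ξ (n + 1)),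
      ∑ j ∈ Finset.range (N + 1),
        (∑ i ∈ Finset.range (d j + 1), A i j * x ^ i) *
          iteratedDerivWithin j (F n) (Set.Icc (ξ n) (ξ (n + 1))) x = 0)
    (m : ℤ → ℝ)
    (hm : ∀ k : ℕ, m k = ∑ n ∈ Finset.range (p + 1),
      ∫ x in (ξ n)..(ξ (n + 1)), x ^ k * F n x)
    (hm0 : ∀ k : ℤ, k < 0 → m k = 0)
    (c : ℕ → ℝ)
    (hc : ∀ t, c t =
      (∏ n ∈ Finset.range (p + 2), (Polynomial.X - Polynomial.C (ξ n)) ^ N).coeff t) :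
    ∀ k : ℕ, ∑ t ∈ Finset.range (N * (p + 2) + 1), c t *
      ∑ j ∈ Finset.range (N + 1), ∑ i ∈ Finset.range (d j + 1),
        A i j * (-1) ^ j * fallingFactorial ((i : ℝ) + k + t) j *
          m ((k : ℤ) + t + i - j) = 0 := by
  intro k
  set Q : ℝ[X] := ∏ n ∈ Finset.range (p + 2), (X - C (ξ n)) ^ N with hQ
  set P : ℕ → ℝ[X] := fun j => ∑ i ∈ Finset.range (d j + 1), C (A i j) * X ^ i with hP
  have hIcc {n : ℕ} (hn : n ≤ p) : Set.uIcc (ξ n) (ξ (n + 1)) = Set.Icc (ξ n) (ξ (n + 1)) :=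
    Set.uIcc_of_le (hξmono n hn).le
  obtain ⟨L, hL⟩ := exists_linearMap_eq_sum_integral ξ F (Finset.range (p + 1)) fun n hn => by
    have hn := Nat.lt_succ_iff.1 (Finset.mem_range.1 hn)
    rw [hIcc hn]
    exact (hF n hn).continuousOn
  have hLX (k : ℕ) : L (X ^ k) = m k := by
    simp [hL, hm]
  have hdeg : Q.natDegree < N * (p + 2) + 1 := by
    rw [Nat.lt_succ_iff, hQ, natDegree_prod_of_monic _ _ fun n _ => (monic_X_sub_C _).pow N]
    simp [mul_comm]
  have hQsum : Q = ∑ t ∈ Finset.range (N * (p + 2) + 1), C (c t) * X ^ t := by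
    simp only [hc]
    exact Q.as_sum_range_C_mul_X_pow' hdeg
  have hdvd {n : ℕ} (hn : n ≤ p + 1) {j : ℕ} (hj : j ≤ N) :
      (X - C (ξ n)) ^ j ∣ X ^ k * Q * P j := by
    have h : (X - C (ξ n)) ^ N ∣ Q :=
      Finset.dvd_prod_of_mem (fun n => (X - C (ξ n)) ^ N) (Finset.mem_range.2 (by omega))
    exact (((pow_dvd_pow _ hj).trans h).mul_left _).mul_right _
  have hexpand (j : ℕ) : X ^ k * Q * P j =
      ∑ t ∈ Finset.range (N * (p + 2) + 1), ∑ i ∈ Finset.range (d j + 1),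
        (c t * A i j) • X ^ (i + k + t) := by
    rw [hQsum, Finset.mul_sum (s := Finset.range (N * (p + 2) + 1)), Finset.sum_mul]
    refine Finset.sum_congr rfl fun t _ => ?_
    rw [hP, Finset.mul_sum]
    refine Finset.sum_congr rfl fun i _ => ?_
    rw [smul_eq_C_mul, C_mul]
    ring
  have hmoment (j : ℕ) : L (derivative^[j] (X ^ k * Q * P j)) =
      ∑ t ∈ Finset.range (N * (p + 2) + 1), ∑ i ∈ Finset.range (d j + 1),
        c t * A i j * (fallingFactorial ((i : ℝ) + k + t) j * m ((k : ℤ) + t + i - j)) := by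
    rw [hexpand]
    simp only [iterate_derivative_sum, iterate_derivative_smul, map_sum, map_smul, smul_eq_mul]
    refine Finset.sum_congr rfl fun t _ => Finset.sum_congr rfl fun i _ => ?_
    rw [map_iterate_derivative_X_pow hLX]
    push_cast
    rw [show (i : ℤ) + k + t - j = k + t + i - j by ring]
  have hzero : ∑ j ∈ Finset.range (N + 1),
      (-1) ^ j * L (derivative^[j] (X ^ k * Q * P j)) = 0 := by
    simp only [hL, Finset.mul_sum]
    rw [Finset.sum_comm]
    refine Finset.sum_eq_zero fun n hn => ?_
    have hn : n ≤ p := Nat.lt_succ_iff.1 (Finset.mem_range.1 hn)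
    have hs := uniqueDiffOn_Icc (hξmono n hn)
    calc
      _ = ∑ j ∈ Finset.range (N + 1), ∫ x in (ξ n)..(ξ (n + 1)),
          (X ^ k * Q * P j).eval x *
            iteratedDerivWithin j (F n) (Set.Icc (ξ n) (ξ (n + 1))) x :=
        Finset.sum_congr rfl fun j hj => by
          have hj : j ≤ N := Nat.lt_succ_iff.1 (Finset.mem_range.1 hj)
          exact (integral_eval_mul_iteratedDerivWithin (hξmono n hn) (hF n hn) hj
            (hdvd (by omega) hj) (hdvd (by omega) hj)).symm
      _ = ∫ x in (ξ n)..(ξ (n + 1)), ∑ j ∈ Finset.range (N + 1),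
          (X ^ k * Q * P j).eval x *
            iteratedDerivWithin j (F n) (Set.Icc (ξ n) (ξ (n + 1))) x := by
        refine (intervalIntegral.integral_finsetSum fun j hj => ?_).symm
        have hj : j ≤ N := Nat.lt_succ_iff.1 (Finset.mem_range.1 hj)
        refine ((X ^ k * Q * P j).continuous.continuousOn.mul ?_).intervalIntegrable
        rw [hIcc hn]
        exact (hF n hn).continuousOn_iteratedDerivWithin (mod_cast hj) hs
      _ = ∫ x in (ξ n)..(ξ (n + 1)), (0 : ℝ) := by
        refine intervalIntegral.integral_congr fun x hx => ?_
        rw [hIcc hn] at hx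
        have hx0 := hode n hn x hx
        simp only [eval_mul, mul_assoc, ← Finset.mul_sum]
        simp only [hP, eval_finsetSum, eval_mul, eval_C, eval_pow, eval_X, hx0, mul_zero]
      _ = 0 := intervalIntegral.integral_zero
  rw [← hzero]
  simp only [hmoment, Finset.mul_sum]
  rw [Finset.sum_comm]
  refine Finset.sum_congr rfl fun j _ => Finset.sum_congr rfl fun t _ =>
    Finset.sum_congr rfl fun i _ => ?_
  ring
end
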